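/- For every i ∈ 𝓘 and every α ∈ (ℤI)^G, the element S_i := ∏_{i'∈𝒪_i} r_{i'} of the Weyl group W(Q) satisfies f(S_i(α)) = γ_i(f(α)) in ℤ𝓘. -/

import Mathlib

/-!
STATEMENT 1: For every `i ∈ 𝓘` and every `G`-fixed `α ∈ (ℤI)^G`, the element
`S_i = ∏_{i' ∈ 𝒪_i} r_{i'}` of the Weyl group `W(Q)` satisfies
`f (S_i α) = γ_i (f α)` in `ℤ𝓘`.
-/

open Finset

section McKayLattice

variable (G : Type) [Group G] [Fintype G]
variable {I : Type} [Fintype I] [DecidableEq I]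

/-- The orbit of a vertex under the `G`-action, as a `Finset`. -/
def orbitF [MulAction G I] (i : I) : Finset I := Finset.univ.image (fun g : G => g • i)

/-- `d_i`, the size of the orbit of the vertex `i`. -/
def dOrb [MulAction G I] (i : I) : ℕ := (orbitF G i).card

/-- The entries of the (symmetric) Cartan matrix of the quiver `Q`, where `n i j` is the
number of edges between the vertices `i` and `j`:  `a i i = 2`, `a i j = -(n i j)` else. -/
def aMat (n : I → I → ℕ) (i j : I) : ℤ := if i = j then 2 else -(n i j : ℤ)

/-- The symmetric bilinear form `(-,-)_Q` on the root lattice `ℤI`,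
determined by `(ε_i, ε_j)_Q = a i j`. -/
def pairQ (n : I → I → ℕ) (α β : I → ℤ) : ℤ := ∑ i, ∑ j, aMat n i j * α i * β j

/-- The simple root `ε_i` in the root lattice. -/
def eps (i : I) : I → ℤ := Pi.single i 1

/-- The action of `g ∈ G` on the root lattice `ℤI`, given by `g (ε_i) = ε_{g i}`. -/
def gact [MulAction G I] (g : G) (α : I → ℤ) : I → ℤ := fun i => α (g⁻¹ • i)

variable {ι : Type} [Fintype ι] [DecidableEq ι]

/-- The symmetric matrix `B` of the valued graph `Γ` of `(Q, G)`, indexed by the set `𝓘` of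
orbit representatives `rep : ι → I`:  `b k k = 2 d_k`, and for `k ≠ l`,
`b k l = -(number of edges between the orbits 𝒪_k and 𝒪_l)`. -/
def bMat [MulAction G I] (n : I → I → ℕ) (rep : ι → I) (k l : ι) : ℤ :=
  if k = l then 2 * (dOrb G (rep k) : ℤ)
  else -(∑ i ∈ orbitF G (rep k), ∑ j ∈ orbitF G (rep l), (n i j : ℤ))

/-- The bilinear form on the root lattice `ℤ𝓘` of a valued graph determined by a symmetric
matrix `b`, via `(ε̄_k, ε̄_l)_Γ = b k l`. -/
def pairV (b : ι → ι → ℤ) (x y : ι → ℤ) : ℤ := ∑ k, ∑ l, b k l * x k * y l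

/-- The canonical map `f : (ℤI)^G → ℤ𝓘`, `f (Σ α_i ε_i) = Σ_{k ∈ 𝓘} α_{rep k} ε̄_k`. -/
def fmap (rep : ι → I) (α : I → ℤ) : ι → ℤ := fun k => α (rep k)

end McKayLattice

section Reflections

variable (G : Type) [Group G] [Fintype G]
variable {I : Type} [Fintype I] [DecidableEq I]
variable {ι : Type} [Fintype ι] [DecidableEq ι]

/-- The reflection `γ_k : α ↦ α - (1/d_k) (α, ε̄_k)_Γ ε̄_k` on the root lattice `ℤ𝓘` of the
valued graph `Γ` of `(Q, G)`.  (The integer `(α, ε̄_k)_Γ` is divisible by `d_k`, so the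
integer division is exact.) -/
def gammaRef [MulAction G I] (n : I → I → ℕ) (rep : ι → I) (k : ι) (x : ι → ℤ) : ι → ℤ :=
  x - (pairV (bMat G n rep) x (eps k) / (dOrb G (rep k) : ℤ)) • eps k

end Reflections

section OrbitLemmas

variable {G I : Type} [Group G] [Fintype G] [DecidableEq I] [MulAction G I]

theorem mem_orbitF {i j : I} : j ∈ orbitF G i ↔ ∃ g : G, g • i = j := by
  simp [orbitF]

theorem mem_orbitF_self (i : I) : i ∈ orbitF G i :=
  mem_orbitF.2 ⟨1, one_smul G i⟩

theorem eq_zero_of_mem_orbitF {n : I → I → ℕ} (hadm : ∀ i j : I, j ∈ orbitF G i → n i j = 0)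
    {x i j : I} (hi : i ∈ orbitF G x) (hj : j ∈ orbitF G x) : n i j = 0 := by
  obtain ⟨g, rfl⟩ := mem_orbitF.1 hi
  obtain ⟨h, rfl⟩ := mem_orbitF.1 hj
  exact hadm _ _ (mem_orbitF.2 ⟨h * g⁻¹, by simp [mul_smul]⟩)

theorem bMat_eq_sum_aMat {ι : Type} [DecidableEq ι] {n : I → I → ℕ}
    (hadm : ∀ i j : I, j ∈ orbitF G i → n i j = 0)
    {rep : ι → I} (hrep : ∀ i : I, ∃! k : ι, i ∈ orbitF G (rep k)) (l k : ι) :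
    bMat G n rep l k = ∑ i ∈ orbitF G (rep l), ∑ j ∈ orbitF G (rep k), aMat n i j := by
  rcases eq_or_ne l k with rfl | hlk
  · have h : ∀ i ∈ orbitF G (rep l), ∑ j ∈ orbitF G (rep l), aMat n i j = 2 := by
      intro i hi
      rw [Finset.sum_eq_single_of_mem i hi]
      · simp [aMat]
      · intro j hj hji
        simp [aMat, hji.symm, eq_zero_of_mem_orbitF hadm hi hj]
    simp [Finset.sum_congr rfl h, bMat, dOrb, mul_comm]
  · simp only [bMat, if_neg hlk, ← Finset.sum_neg_distrib]
    refine Finset.sum_congr rfl fun i hi => Finset.sum_congr rfl fun j hj => ?_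
    have hij : i ≠ j := by
      rintro rfl
      exact hlk ((hrep i).unique hi hj)
    simp [aMat, hij]

end OrbitLemmas

theorem apply_smul_of_gact_eq {G I : Type} [Group G] [MulAction G I] {α : I → ℤ}
    (hα : ∀ g : G, gact G g α = α) (g : G) (i : I) : α (g • i) = α i := by
  simpa [gact] using congrFun (hα g⁻¹) i

section RootLattice

variable {I : Type} [Fintype I] [DecidableEq I]

theorem pairQ_eps (n : I → I → ℕ) (α : I → ℤ) (a : I) :
    pairQ n α (eps a) = ∑ i, aMat n i a * α i := by
  simp [pairQ, eps, Pi.single_apply]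

theorem pairV_eps {ι : Type} [Fintype ι] [DecidableEq ι] (b : ι → ι → ℤ) (x : ι → ℤ) (k : ι) :
    pairV b x (eps k) = ∑ l, b l k * x l := by
  simp [pairV, eps, Pi.single_apply]

theorem pairQ_sub_sum_smul_eps (n : I → I → ℕ) (α c : I → ℤ) (T : Finset I) (a : I) :
    pairQ n (α - ∑ i ∈ T, c i • eps i) (eps a) =
      pairQ n α (eps a) - ∑ i ∈ T, aMat n i a * c i := by
  rw [pairQ_eps, pairQ_eps]
  simp [eps, Finset.sum_apply, Pi.single_apply, mul_sub, Finset.sum_sub_distrib]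

/-- A product of reflections at pairwise non-adjacent vertices subtracts the corresponding
multiples of simple roots simultaneously. -/
theorem noncommProd_reflection_apply (n : I → I → ℕ) (r : I → Equiv.Perm (I → ℤ))
    (hr : ∀ (i : I) (α : I → ℤ), r i α = α - pairQ n α (eps i) • eps i) (α : I → ℤ)
    (T : Finset I) (hT : ∀ i ∈ T, ∀ j ∈ T, n i j = 0)
    (hcomm : (↑T : Set I).Pairwise fun a b => Commute (r a) (r b)) :
    T.noncommProd r hcomm α = α - ∑ i ∈ T, pairQ n α (eps i) • eps i := by
  induction T using Finset.induction_on with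
  | empty => simp
  | insert a T ha ih =>
    have hz : ∑ i ∈ T, aMat n i a * pairQ n α (eps i) = 0 := by
      refine Finset.sum_eq_zero fun i hi => ?_
      have hia : i ≠ a := fun h => ha (h ▸ hi)
      simp [aMat, hia, hT i (Finset.mem_insert_of_mem hi) a (Finset.mem_insert_self a T)]
    rw [Finset.noncommProd_insert_of_notMem _ _ _ _ ha, Equiv.Perm.mul_apply,
      ih fun i hi j hj => hT i (Finset.mem_insert_of_mem hi) j (Finset.mem_insert_of_mem hj),
      hr, pairQ_sub_sum_smul_eps, hz, Finset.sum_insert ha, sub_zero]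
    abel

variable {G : Type} [Group G] [MulAction G I]

theorem pairQ_eps_smul {n : I → I → ℕ} (hinv : ∀ (g : G) (i j : I), n (g • i) (g • j) = n i j)
    {α : I → ℤ} (hα : ∀ g : G, gact G g α = α) (g : G) (a : I) :
    pairQ n α (eps (g • a)) = pairQ n α (eps a) := by
  rw [pairQ_eps, pairQ_eps, ← Equiv.sum_comp (MulAction.toPerm g)]
  simp [aMat, hinv, apply_smul_of_gact_eq hα]

variable [Fintype G]

theorem sum_eq_sum_orbitF {ι : Type} [Fintype ι] {rep : ι → I}
    (hrep : ∀ i : I, ∃! k : ι, i ∈ orbitF G (rep k)) (F : I → ℤ) :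
    ∑ i, F i = ∑ l, ∑ i ∈ orbitF G (rep l), F i := by
  rw [← Finset.sum_biUnion]
  · refine Finset.sum_congr (Finset.ext fun i => ?_) fun _ _ => rfl
    simpa using (hrep i).exists
  · intro l _ m _ hlm
    exact Finset.disjoint_left.2 fun i hi hj => hlm ((hrep i).unique hi hj)

theorem pairV_fmap_eps {ι : Type} [Fintype ι] [DecidableEq ι] {n : I → I → ℕ}
    (hadm : ∀ i j : I, j ∈ orbitF G i → n i j = 0)
    (hinv : ∀ (g : G) (i j : I), n (g • i) (g • j) = n i j)
    {rep : ι → I} (hrep : ∀ i : I, ∃! k : ι, i ∈ orbitF G (rep k))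
    {α : I → ℤ} (hα : ∀ g : G, gact G g α = α) (k : ι) :
    pairV (bMat G n rep) (fmap rep α) (eps k) =
      dOrb G (rep k) * pairQ n α (eps (rep k)) := by
  have hc : ∀ j ∈ orbitF G (rep k), pairQ n α (eps j) = pairQ n α (eps (rep k)) := by
    intro j hj
    obtain ⟨g, rfl⟩ := mem_orbitF.1 hj
    exact pairQ_eps_smul hinv hα g _
  calc pairV (bMat G n rep) (fmap rep α) (eps k)
      = ∑ l, ∑ i ∈ orbitF G (rep l), ∑ j ∈ orbitF G (rep k), aMat n i j * α i := by
        rw [pairV_eps]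
        refine Finset.sum_congr rfl fun l _ => ?_
        rw [bMat_eq_sum_aMat hadm hrep, Finset.sum_mul]
        refine Finset.sum_congr rfl fun i hi => ?_
        obtain ⟨g, rfl⟩ := mem_orbitF.1 hi
        rw [Finset.sum_mul, apply_smul_of_gact_eq hα, fmap]
    _ = ∑ j ∈ orbitF G (rep k), pairQ n α (eps j) := by
        rw [← sum_eq_sum_orbitF hrep, Finset.sum_comm]
        simp only [pairQ_eps]
    _ = dOrb G (rep k) * pairQ n α (eps (rep k)) := by
        rw [Finset.sum_congr rfl hc]
        simp [dOrb]

end RootLattice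

/-- Let `Q` be a finite loopless quiver with an admissible action of a finite
group `G`, `Γ` the valued graph of `(Q, G)` and `f : (ℤI)^G → ℤ𝓘` the canonical bijection.
Let `r i` be the simple reflection `α ↦ α - (α, ε_i)_Q ε_i` of the Weyl group `W(Q)` (realized
as permutations of the root lattice).  By admissibility the reflections `r i'` for `i'` in one
`G`-orbit pairwise commute, so `S_k := ∏_{i' ∈ 𝒪_{rep k}} r_{i'} ∈ W(Q)` is well defined; then
for every `G`-fixed `α` we have `f (S_k α) = γ_k (f α)`. -/
theorem statement1
    (G : Type) [Group G] [Fintype G]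
    {I : Type} [Fintype I] [DecidableEq I] [MulAction G I]
    {ι : Type} [Fintype ι] [DecidableEq ι]
    (n : I → I → ℕ) (rep : ι → I)
    (hsymm : ∀ i j, n i j = n j i)
    (hadm : ∀ i j : I, j ∈ orbitF G i → n i j = 0)
    (hinv : ∀ (g : G) (i j : I), n (g • i) (g • j) = n i j)
    (hrep : ∀ i : I, ∃! k : ι, i ∈ orbitF G (rep k))
    (r : I → Equiv.Perm (I → ℤ))
    (hr : ∀ (i : I) (α : I → ℤ), r i α = α - pairQ n α (eps i) • eps i)
    (k : ι)
    (hcomm : (↑(orbitF G (rep k)) : Set I).Pairwise fun a b => Commute (r a) (r b))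
    (α : I → ℤ) (hα : ∀ g : G, gact G g α = α) :
    fmap rep (((orbitF G (rep k)).noncommProd r hcomm) α) = gammaRef G n rep k (fmap rep α) := by
  have hd : (dOrb G (rep k) : ℤ) ≠ 0 := by
    exact_mod_cast (Finset.card_pos.2 ⟨_, mem_orbitF_self (G := G) (rep k)⟩).ne'
  have hT : ∀ i ∈ orbitF G (rep k), ∀ j ∈ orbitF G (rep k), n i j = 0 :=
    fun i hi j hj => eq_zero_of_mem_orbitF hadm hi hj
  rw [noncommProd_reflection_apply n r hr α _ hT, gammaRef, pairV_fmap_eps hadm hinv hrep hα,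
    Int.mul_ediv_cancel_left _ hd]
  funext l
  have hl : rep l ∈ orbitF G (rep k) ↔ l = k :=
    ⟨fun h => (hrep (rep l)).unique (mem_orbitF_self _) h, fun h => h ▸ mem_orbitF_self _⟩
  rcases eq_or_ne l k with rfl | hlk
  · simp [fmap, eps, Finset.sum_apply, Pi.single_apply, mem_orbitF_self]
  · simp [fmap, eps, Finset.sum_apply, Pi.single_apply, hl, hlk]
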